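/- For every family of bijections (α_k)_{k∈ℕ} as in the definition of 3SATC, the Boolean function family 3SATC = (3SATC_n)_{n∈ℕ} is PLSIS-complete. -/

import Mathlib

/-- Boolean register names: `inp i` is input register `in:(i+1)`,
`aux i` is auxiliary register `aux:(i+1)`, `out` is the output register. -/
inductive Reg where
  | inp : ℕ → Reg
  | aux : ℕ → Reg
  | out : Reg
deriving DecidableEq

/-- Basic instructions: register reads/writes, and (for splitting instruction
sequences) `split p` and `reply p` for Boolean parameters `p`. -/
inductive BInstr where
  | get : Reg → BInstr
  | set : Reg → Bool → BInstr
  | split : ℕ → BInstr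
  | reply : ℕ → BInstr
deriving DecidableEq

/-- Primitive instructions. -/
inductive PInstr where
  | plain : BInstr → PInstr
  | pos : BInstr → PInstr
  | neg : BInstr → PInstr
  | jump : ℕ → PInstr
  | halt : PInstr
deriving DecidableEq

abbrev RegState := Reg → Bool

/-- State change caused by processing a basic instruction. -/
def BInstr.effect : BInstr → RegState → RegState
  | .set r b, s => Function.update s r b
  | _, s => s

/-- Reply produced by processing a basic instruction. -/
def BInstr.rpl : BInstr → RegState → Bool
  | .get r, s => s r
  | .set _ b, _ => b
  | _, _ => false

def BInstr.isSplitReply : BInstr → Bool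
  | .split _ => true
  | .reply _ => true
  | _ => false

/-- Single-thread execution of an instruction sequence on Boolean registers;
`none` means deadlock, `some s` means termination in register state `s`.
(`split`/`reply` instructions make no sense here and deadlock.) -/
def exec : List PInstr → RegState → Option RegState
  | [], _ => none
  | .plain a :: X, s =>
      if a.isSplitReply then none else exec X (a.effect s)
  | .pos a :: X, s =>
      if a.isSplitReply then none
      else if a.rpl s then exec X (a.effect s) else exec (X.drop 1) (a.effect s)
  | .neg a :: X, s =>
      if a.isSplitReply then none
      else if a.rpl s then exec (X.drop 1) (a.effect s) else exec X (a.effect s)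
  | .jump 0 :: _, _ => none
  | .jump (l+1) :: X, s => exec (X.drop l) s
  | .halt :: _, s => some s
termination_by X _ => X.length
decreasing_by all_goals (simp only [List.length_drop, List.length_cons]; omega)

/-- Initial register state: input registers `in:1 .. in:n` contain
`b 0, ..., b (n-1)`; all other registers contain `false`. -/
def initState (n : ℕ) (b : Fin n → Bool) : RegState := fun r =>
  match r with
  | .inp i => if h : i < n then b ⟨i, h⟩ else false
  | _ => false

/-- `X` computes the `n`-ary Boolean function `f`: for every input, execution
terminates (does not deadlock) with the output register containing `f b`. -/
def Computes {n : ℕ} (f : (Fin n → Bool) → Bool) (X : List PInstr) : Prop :=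
  ∀ b : Fin n → Bool, ∃ s : RegState,
    exec X (initState n b) = some s ∧ s Reg.out = f b

/-- Basic instructions allowed in `IS_br`. -/
def BrBasic : BInstr → Prop
  | .get (.inp _) => True
  | .get (.aux _) => True
  | .set (.aux _) _ => True
  | .set .out _ => True
  | _ => False

/-- Basic instructions allowed in `IS_br^na`. -/
def NaBasic : BInstr → Prop
  | .get (.inp _) => True
  | .set .out _ => True
  | _ => False

def InstrBasicOK (P : BInstr → Prop) : PInstr → Prop
  | .plain a => P a
  | .pos a => P a
  | .neg a => P a
  | _ => True

/-- Membership of `IS_br` (non-empty, only allowed basic instructions). -/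
def ISbr (X : List PInstr) : Prop :=
  X ≠ [] ∧ ∀ u ∈ X, InstrBasicOK BrBasic u

/-- Membership of `IS_br^na`. -/
def ISbrna (X : List PInstr) : Prop :=
  X ≠ [] ∧ ∀ u ∈ X, InstrBasicOK NaBasic u

/-- The primitive instruction contains the basic instruction `out.set:false`. -/
def UsesOutSetFalse : PInstr → Prop
  | .plain (.set .out false) => True
  | .pos (.set .out false) => True
  | .neg (.set .out false) => True
  | _ => False

/-- The class PLIS of Boolean function families computable by
polynomial-length instruction sequences from `IS_br`. -/
def PLIS (F : (n : ℕ) → (Fin n → Bool) → Bool) : Prop :=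
  ∃ h : Polynomial ℕ, ∀ n : ℕ, ∃ X : List PInstr,
    ISbr X ∧ Computes (F n) X ∧ X.length ≤ h.eval n

/-- Basic instructions allowed in `SIS_br`. -/
def SisBasic : BInstr → Prop
  | .get (.inp _) => True
  | .set .out true => True
  | .split _ => True
  | .reply _ => True
  | _ => False

/-- Membership of `SIS_br`. -/
def SISbr (X : List PInstr) : Prop :=
  X ≠ [] ∧ ∀ u ∈ X, InstrBasicOK SisBasic u

/-- A (partial) instantiation of the Boolean parameters. -/
abbrev PEnv := ℕ → Option Bool

/-- Fueled cyclic-interleaving execution of a vector of threads (each a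
remaining instruction sequence with a parameter instantiation) sharing the
Boolean registers.  `none` means deadlock (or not enough fuel), `some s`
means successful termination of all threads in register state `s`. -/
def sexec : ℕ → List (List PInstr × PEnv) → RegState → Option RegState
  | 0, _, _ => none
  | _ + 1, [], s => some s
  | fuel + 1, (is, ρ) :: ts, s =>
    match is with
    | [] => none
    | .halt :: _ => sexec fuel ts s
    | .jump 0 :: _ => none
    | .jump (l+1) :: X => sexec fuel ((X.drop l, ρ) :: ts) s
    | .plain a :: X =>
      match a with
      | .split p =>
        match ρ p with
        | some _ => none
        | none => sexec fuel
            (ts ++ [(X, Function.update ρ p (some true)),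
                    (X, Function.update ρ p (some false))]) s
      | .reply p =>
        match ρ p with
        | none => none
        | some _ => sexec fuel (ts ++ [(X, ρ)]) s
      | _ => sexec fuel (ts ++ [(X, ρ)]) (a.effect s)
    | .pos a :: X =>
      match a with
      | .split p =>
        match ρ p with
        | some _ => none
        | none => sexec fuel
            (ts ++ [(X, Function.update ρ p (some true)),
                    (X.drop 1, Function.update ρ p (some false))]) s
      | .reply p =>
        match ρ p with
        | none => none
        | some b => sexec fuel (ts ++ [(if b then X else X.drop 1, ρ)]) s
      | _ => sexec fuel (ts ++ [(if a.rpl s then X else X.drop 1, ρ)]) (a.effect s)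
    | .neg a :: X =>
      match a with
      | .split p =>
        match ρ p with
        | some _ => none
        | none => sexec fuel
            (ts ++ [(X.drop 1, Function.update ρ p (some true)),
                    (X, Function.update ρ p (some false))]) s
      | .reply p =>
        match ρ p with
        | none => none
        | some b => sexec fuel (ts ++ [(if b then X.drop 1 else X, ρ)]) s
      | _ => sexec fuel (ts ++ [(if a.rpl s then X.drop 1 else X, ρ)]) (a.effect s)

/-- `X` splitting computes the `n`-ary Boolean function `f`. -/
def SplittingComputes {n : ℕ} (f : (Fin n → Bool) → Bool) (X : List PInstr) : Prop :=
  ∀ b : Fin n → Bool, ∃ (fuel : ℕ) (s : RegState),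
    sexec fuel [(X, fun _ => none)] (initState n b) = some s ∧ s Reg.out = f b

/-- The class PLSIS of Boolean function families splitting computable by
polynomial-length instruction sequences from `SIS_br`. -/
def PLSIS (F : (n : ℕ) → (Fin n → Bool) → Bool) : Prop :=
  ∃ h : Polynomial ℕ, ∀ n : ℕ, ∃ X : List PInstr,
    SISbr X ∧ SplittingComputes (F n) X ∧ X.length ≤ h.eval n

/-- `f` is length-`l` reducible to `g`. -/
def LengthRed (l : ℕ) {n m : ℕ} (f : (Fin n → Bool) → Bool)
    (g : (Fin m → Bool) → Bool) : Prop :=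
  ∃ h : Fin m → (Fin n → Bool) → Bool,
    (∀ j : Fin m, ∃ X : List PInstr, ISbr X ∧ Computes (h j) X ∧ X.length ≤ l) ∧
    ∀ b : Fin n → Bool, f b = g (fun j => h j b)

/-- Non-uniform polynomial-length reducibility of Boolean function families. -/
def PLRed (F G : (n : ℕ) → (Fin n → Bool) → Bool) : Prop :=
  ∃ q : Polynomial ℕ, ∀ n : ℕ, ∃ l m : ℕ,
    l ≤ q.eval n ∧ m ≤ q.eval n ∧ LengthRed l (F n) (G m)

/-- PLSIS-completeness. -/
def PLSISComplete (F : (n : ℕ) → (Fin n → Bool) → Bool) : Prop :=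
  PLSIS F ∧ ∀ G : (n : ℕ) → (Fin n → Bool) → Bool, PLSIS G → PLRed G F

/-- `ndisj k` = C(2k,1) + C(2k,2) + C(2k,3), the number of non-empty sets of
at most 3 literals over the variables `v_1, ..., v_k`. -/
def ndisj (k : ℕ) : ℕ :=
  Nat.choose (2*k) 1 + Nat.choose (2*k) 2 + Nat.choose (2*k) 3

/-- A literal is a pair (variable index, polarity): `(i, true)` is `v_i` and
`(i, false)` is `¬ v_i`.  `LitSetOK k L` says `L` is a non-empty set of at
most 3 literals over `v_1, ..., v_k`. -/
def LitSetOK (k : ℕ) (L : Finset (ℕ × Bool)) : Prop :=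
  L.Nonempty ∧ L.card ≤ 3 ∧ ∀ p ∈ L, 1 ≤ p.1 ∧ p.1 ≤ k

/-- A family of bijections `α_k` from `[1, ndisj k]` to the non-empty sets of
at most 3 literals over `v_1, ..., v_k`, compatible in the sense that
`α_{i+1}` extends `α_i`. -/
structure AlphaFamily where
  α : ℕ → ℕ → Finset (ℕ × Bool)
  maps : ∀ k i, 1 ≤ i → i ≤ ndisj k → LitSetOK k (α k i)
  inj : ∀ k i j, 1 ≤ i → i ≤ ndisj k → 1 ≤ j → j ≤ ndisj k → α k i = α k j → i = j
  surj : ∀ k L, LitSetOK k L → ∃ i, 1 ≤ i ∧ i ≤ ndisj k ∧ α k i = L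
  compat : ∀ i j, 1 ≤ j → j ≤ ndisj i → α (i+1) j = α i j

/-- The largest `k` with `ndisj k ≤ n`. -/
def kOf (n : ℕ) : ℕ := Nat.findGreatest (fun k => ndisj k ≤ n) n

/-- `3SATC_n (b_1, ..., b_n)` is `true` iff the conjunction, over all
`i ∈ [1, ndisj (kOf n)]` with `b_i = true`, of the disjunction of the
literals in `α_{kOf n} (i)` is satisfiable (here `b i` for `i : Fin n` is
`b_{i+1}`; an assignment `σ` satisfies a literal `(j, c)` iff `σ j = c`). -/
noncomputable def threeSATC (A : AlphaFamily) (n : ℕ) (b : Fin n → Bool) : Bool :=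
  @decide
    (∃ σ : ℕ → Bool, ∀ i : Fin n, i.1 + 1 ≤ ndisj (kOf n) → b i = true →
      ∃ p ∈ A.α (kOf n) (i.1 + 1), σ p.1 = p.2)
    (Classical.propDecidable _)

namespace Reg3SAT

/-! ### Runs of a single thread under a total parameter assignment -/

/-- The basic instruction writes a register. -/
def isSet : BInstr → Bool
  | .set _ _ => true
  | _ => false

/-- Reply to a basic instruction when the input registers contain `x` and the
Boolean parameters are instantiated according to `σ`. -/
def ans (x σ : ℕ → Bool) : BInstr → Bool
  | .get (.inp j) => x j
  | .get _ => false
  | .set _ b => b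
  | .split p => σ p
  | .reply p => σ p

/-- The run of a thread with inputs `x` and parameters `σ` performs a write. -/
def hits (x σ : ℕ → Bool) : List PInstr → Bool
  | [] => false
  | .halt :: _ => false
  | .jump 0 :: _ => false
  | .jump (l+1) :: X => hits x σ (X.drop l)
  | .plain a :: X => isSet a || hits x σ X
  | .pos a :: X => isSet a || if ans x σ a then hits x σ X else hits x σ (X.drop 1)
  | .neg a :: X => isSet a || if ans x σ a then hits x σ (X.drop 1) else hits x σ X
termination_by X => X.length
decreasing_by all_goals (simp only [List.length_drop, List.length_cons]; omega)

/-- The total assignment `σ` extends the partial instantiation `ρ`. -/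
def Extends (ρ : PEnv) (σ : ℕ → Bool) : Prop := ∀ p v, ρ p = some v → σ p = v

/-- Some total assignment extending the instantiation of the thread makes it
perform a write. -/
def MayHit (x : ℕ → Bool) (t : List PInstr × PEnv) : Prop :=
  ∃ σ, Extends t.2 σ ∧ hits x σ t.1 = true

/-- All instructions of the thread are allowed in `SIS_br`. -/
def Allowed (X : List PInstr) : Prop := ∀ u ∈ X, InstrBasicOK SisBasic u

theorem Allowed.tail {u : PInstr} {X : List PInstr} (h : Allowed (u :: X)) : Allowed X :=
  fun v hv => h v (List.mem_cons_of_mem _ hv)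

theorem Allowed.drop {X : List PInstr} (h : Allowed X) (l : ℕ) : Allowed (X.drop l) :=
  fun v hv => h v (List.mem_of_mem_drop hv)

theorem extends_update {ρ : PEnv} {p : ℕ} (h : ρ p = none) (v : Bool) (σ : ℕ → Bool) :
    Extends (Function.update ρ p (some v)) σ ↔ Extends ρ σ ∧ σ p = v := by
  constructor
  · intro H
    refine ⟨fun q w hq => H q w ?_, H p v (by simp)⟩
    have : q ≠ p := by rintro rfl; simp [h] at hq
    simpa [Function.update_of_ne this] using hq
  · rintro ⟨H, hp⟩ q w hq
    by_cases hqp : q = p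
    · subst hqp; simp at hq; rw [hp, hq]
    · rw [Function.update_of_ne hqp] at hq; exact H q w hq

theorem mayHit_split {x : ℕ → Bool} {ρ : PEnv} {p : ℕ} (h : ρ p = none)
    {U X Y : List PInstr}
    (hU : ∀ σ, hits x σ U = if σ p then hits x σ X else hits x σ Y) :
    MayHit x (U, ρ) ↔ MayHit x (X, Function.update ρ p (some true)) ∨
      MayHit x (Y, Function.update ρ p (some false)) := by
  simp only [MayHit, extends_update h, hU]
  constructor
  · rintro ⟨σ, h1, h2⟩
    cases hp : σ p
    · exact Or.inr ⟨σ, ⟨h1, hp⟩, by simpa [hp] using h2⟩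
    · exact Or.inl ⟨σ, ⟨h1, hp⟩, by simpa [hp] using h2⟩
  · rintro (⟨σ, ⟨h1, hp⟩, h2⟩ | ⟨σ, ⟨h1, hp⟩, h2⟩)
    · exact ⟨σ, h1, by simpa [hp] using h2⟩
    · exact ⟨σ, h1, by simpa [hp] using h2⟩

theorem mayHit_congr {x : ℕ → Bool} {ρ : PEnv} {U X : List PInstr}
    (hU : ∀ σ, Extends ρ σ → hits x σ U = hits x σ X) :
    MayHit x (U, ρ) ↔ MayHit x (X, ρ) :=
  exists_congr fun σ => and_congr_right fun h => by rw [hU σ h]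

theorem mayHit_of_hits {x : ℕ → Bool} {ρ : PEnv} {U : List PInstr}
    (hU : ∀ σ, hits x σ U = true) : MayHit x (U, ρ) :=
  ⟨fun p => (ρ p).getD false, fun p v h => by simp [show ρ p = some v from h], hU _⟩

/-- Contents of the input registers. -/
def inputs (s : RegState) : ℕ → Bool := fun j => s (.inp j)

theorem inputs_update_out (s : RegState) (b : Bool) :
    inputs (Function.update s .out b) = inputs s := by
  funext j; simp [inputs]

/-- A successful interleaved execution ends with `out` containing `true` iff it
did so initially or some parameter assignment makes some thread write `out`. -/
theorem sexec_out (fuel : ℕ) : ∀ (ts : List (List PInstr × PEnv)) (s s' : RegState),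
    (∀ t ∈ ts, Allowed t.1) → sexec fuel ts s = some s' →
    (s' .out = true ↔ s .out = true ∨ ∃ t ∈ ts, MayHit (inputs s) t) := by
  induction fuel with
  | zero => intro ts s s' _ h; simp [sexec] at h
  | succ fuel ih =>
    intro ts s s' hok h
    match ts, hok, h with
    | [], _, h =>
      simp [sexec] at h
      simp [h]
    | (is, ρ) :: ts, hok, h =>
      have hts : ∀ t ∈ ts, Allowed t.1 := fun t ht => hok t (List.mem_cons_of_mem _ ht)
      have his : Allowed is := hok (is, ρ) List.mem_cons_self
      -- replacing the first thread by the threads `new`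
      have key : ∀ (new : List (List PInstr × PEnv)), (∀ t ∈ new, Allowed t.1) →
          (MayHit (inputs s) (is, ρ) ↔ ∃ t ∈ new, MayHit (inputs s) t) →
          ∀ ts', (∀ t, t ∈ ts' ↔ t ∈ ts ∨ t ∈ new) → sexec fuel ts' s = some s' →
          (s' .out = true ↔ s .out = true ∨
            ∃ t ∈ (is, ρ) :: ts, MayHit (inputs s) t) := by
        intro new hnew hiff ts' hts' hex
        rw [ih ts' s s' (fun t ht => ((hts' t).1 ht).elim (hts t) (hnew t)) hex]
        simp only [List.exists_mem_cons_iff, hiff, hts', or_and_right, exists_or]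
        exact or_congr_right or_comm
      have one : ∀ Y, Allowed Y →
          (∀ σ, Extends ρ σ → hits (inputs s) σ is = hits (inputs s) σ Y) →
          ∀ ts', (∀ t, t ∈ ts' ↔ t ∈ ts ∨ t ∈ [(Y, ρ)]) → sexec fuel ts' s = some s' →
          (s' .out = true ↔ s .out = true ∨
            ∃ t ∈ (is, ρ) :: ts, MayHit (inputs s) t) := by
        intro Y hY hh
        exact key [(Y, ρ)] (by simpa using hY) (by simpa using mayHit_congr hh)
      have two : ∀ (p : ℕ) (Y Z : List PInstr), ρ p = none → Allowed Y → Allowed Z →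
          (∀ σ, hits (inputs s) σ is =
            if σ p then hits (inputs s) σ Y else hits (inputs s) σ Z) →
          sexec fuel (ts ++ [(Y, Function.update ρ p (some true)),
            (Z, Function.update ρ p (some false))]) s = some s' →
          (s' .out = true ↔ s .out = true ∨
            ∃ t ∈ (is, ρ) :: ts, MayHit (inputs s) t) := by
        intro p Y Z hp hY hZ hh
        exact key [(Y, Function.update ρ p (some true)), (Z, Function.update ρ p (some false))]
          (by simp [hY, hZ]) (by simpa using mayHit_split hp hh) _ (by simp)
      have write : ∀ Y, Allowed Y → (∀ σ, hits (inputs s) σ is = true) →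
          sexec fuel (ts ++ [(Y, ρ)]) (Function.update s .out true) = some s' →
          (s' .out = true ↔ s .out = true ∨
            ∃ t ∈ (is, ρ) :: ts, MayHit (inputs s) t) := by
        intro Y hY hh hex
        rw [ih _ _ s' (by simpa [or_imp, forall_and, hY] using hts) hex]
        simp [mayHit_of_hits hh]
      match is, his with
      | [], _ => simp [sexec] at h
      | .halt :: X, _ =>
        refine key [] (by simp) ?_ ts (by simp) (by simpa [sexec] using h)
        simp [MayHit, hits]
      | .jump 0 :: X, _ => simp [sexec] at h
      | .jump (l+1) :: X, his =>
        refine one (X.drop l) (his.tail.drop l) (fun σ _ => by simp [hits]) _ ?_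
          (by simpa [sexec] using h)
        intro t; simp [or_comm]
      | .plain a :: X, his =>
        have ha := his _ List.mem_cons_self
        match a, ha with
        | .get (.inp j), _ =>
          exact one X his.tail (fun σ _ => by simp [hits, isSet]) (ts ++ [(X, ρ)]) (by simp)
            (by simpa [sexec, BInstr.effect] using h)
        | .set .out true, _ =>
          exact write X his.tail (fun σ => by simp [hits, isSet])
            (by simpa [sexec, BInstr.effect] using h)
        | .split p, _ =>
          cases hp : ρ p with
          | some v => simp [sexec, hp] at h
          | none =>
            exact two p X X hp his.tail his.tail (fun σ => by simp [hits, isSet])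
              (by simpa [sexec, hp] using h)
        | .reply p, _ =>
          cases hp : ρ p with
          | none => simp [sexec, hp] at h
          | some v =>
            exact one X his.tail (fun σ _ => by simp [hits, isSet]) (ts ++ [(X, ρ)]) (by simp)
              (by simpa [sexec, hp] using h)
      | .pos a :: X, his =>
        have ha := his _ List.mem_cons_self
        have hd := his.tail.drop 1
        match a, ha with
        | .get (.inp j), _ =>
          refine one (if s (.inp j) then X else X.drop 1) ?_ (fun σ _ => ?_) _ ?_
            (by simpa [sexec, BInstr.effect, BInstr.rpl] using h)
          · split_ifs <;> [exact his.tail; exact hd]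
          · cases hj : s (.inp j) <;> simp [hits, isSet, ans, inputs, hj]
          · simp
        | .set .out true, _ =>
          exact write X his.tail (fun σ => by simp [hits, isSet])
            (by simpa [sexec, BInstr.effect, BInstr.rpl] using h)
        | .split p, _ =>
          cases hp : ρ p with
          | some v => simp [sexec, hp] at h
          | none =>
            exact two p X (X.drop 1) hp his.tail hd (fun σ => by simp [hits, isSet, ans])
              (by simpa [sexec, hp] using h)
        | .reply p, _ =>
          cases hp : ρ p with
          | none => simp [sexec, hp] at h
          | some v =>
            refine one (if v then X else X.drop 1) ?_ (fun σ hσ => ?_) _ ?_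
              (by simpa [sexec, hp] using h)
            · split_ifs <;> [exact his.tail; exact hd]
            · have := hσ p v hp
              cases v <;> simp [hits, isSet, ans, this]
            · simp
      | .neg a :: X, his =>
        have ha := his _ List.mem_cons_self
        have hd := his.tail.drop 1
        match a, ha with
        | .get (.inp j), _ =>
          refine one (if s (.inp j) then X.drop 1 else X) ?_ (fun σ _ => ?_) _ ?_
            (by simpa [sexec, BInstr.effect, BInstr.rpl] using h)
          · split_ifs <;> [exact hd; exact his.tail]
          · cases hj : s (.inp j) <;> simp [hits, isSet, ans, inputs, hj]
          · simp
        | .set .out true, _ =>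
          exact write (X.drop 1) hd (fun σ => by simp [hits, isSet])
            (by simpa [sexec, BInstr.effect, BInstr.rpl] using h)
        | .split p, _ =>
          cases hp : ρ p with
          | some v => simp [sexec, hp] at h
          | none =>
            exact two p (X.drop 1) X hp hd his.tail (fun σ => by simp [hits, isSet, ans])
              (by simpa [sexec, hp] using h)
        | .reply p, _ =>
          cases hp : ρ p with
          | none => simp [sexec, hp] at h
          | some v =>
            refine one (if v then X.drop 1 else X) ?_ (fun σ hσ => ?_) _ ?_
              (by simpa [sexec, hp] using h)
            · split_ifs <;> [exact hd; exact his.tail]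
            · have := hσ p v hp
              cases v <;> simp [hits, isSet, ans, this]
            · simp

/-- A successful execution of `X` started as a single thread computes whether
some parameter assignment makes `X` write `out`. -/
theorem sexec_start {n : ℕ} {b : Fin n → Bool} {X : List PInstr} {fuel : ℕ} {s : RegState}
    (hX : Allowed X) (h : sexec fuel [(X, fun _ => none)] (initState n b) = some s) :
    s .out = true ↔ ∃ σ, hits (inputs (initState n b)) σ X = true := by
  rw [sexec_out fuel _ _ s (by simpa using hX) h]
  simp [MayHit, Extends, initState]

/-! ### Deadlock-free threads terminate -/

/-- A syntactic criterion under which a thread cannot deadlock. -/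
inductive Safe : List PInstr → PEnv → Prop
  | halt (X ρ) : Safe (.halt :: X) ρ
  | jump (l X ρ) : Safe (X.drop l) ρ → Safe (.jump (l+1) :: X) ρ
  | write (X ρ) : Safe X ρ → Safe (.plain (.set .out true) :: X) ρ
  | split (p X ρ) : ρ p = none → Safe X (Function.update ρ p (some true)) →
      Safe X (Function.update ρ p (some false)) → Safe (.plain (.split p) :: X) ρ
  | posReply (p X ρ) : ρ p ≠ none → Safe X ρ → Safe (X.drop 1) ρ →
      Safe (.pos (.reply p) :: X) ρ
  | negReply (p X ρ) : ρ p ≠ none → Safe X ρ → Safe (X.drop 1) ρ →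
      Safe (.neg (.reply p) :: X) ρ
  | negGet (j X ρ) : Safe X ρ → Safe (X.drop 1) ρ → Safe (.neg (.get (.inp j)) :: X) ρ

/-- Bound on the number of steps that a vector of threads can still perform. -/
def weight (ts : List (List PInstr × PEnv)) : ℕ := (ts.map fun t => 3 ^ t.1.length).sum

theorem sexec_terminates (w : ℕ) : ∀ (ts : List (List PInstr × PEnv)) (s : RegState),
    weight ts ≤ w → (∀ t ∈ ts, Safe t.1 t.2) → ∃ fuel s', sexec fuel ts s = some s' := by
  induction w with
  | zero =>
    intro ts s hw _
    match ts, hw with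
    | [], _ => exact ⟨1, s, by simp [sexec]⟩
    | t :: ts, hw =>
      have : 0 < 3 ^ t.1.length := by positivity
      simp [weight] at hw
  | succ w ih =>
    intro ts s hw hs
    match ts, hw, hs with
    | [], _, _ => exact ⟨1, s, by simp [sexec]⟩
    | (is, ρ) :: ts, hw, hs =>
      have hts : ∀ t ∈ ts, Safe t.1 t.2 := fun t ht => hs t (List.mem_cons_of_mem _ ht)
      have his : Safe is ρ := hs (is, ρ) List.mem_cons_self
      have hlt : ∀ (X : List PInstr) (l : ℕ), 3 ^ (X.drop l).length ≤ 3 ^ X.length :=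
        fun X l => Nat.pow_le_pow_right (by norm_num) (by simp)
      have hpos : ∀ (X : List PInstr), 0 < 3 ^ X.length := fun X => by positivity
      -- one more unit of fuel for the step of the first thread
      have bump : ∀ (ts' : List (List PInstr × PEnv)) (s1 : RegState),
          (∀ fuel, sexec (fuel + 1) ((is, ρ) :: ts) s = sexec fuel ts' s1) →
          weight ts' ≤ w → (∀ t ∈ ts', Safe t.1 t.2) →
          ∃ fuel s', sexec fuel ((is, ρ) :: ts) s = some s' := by
        intro ts' s1 he hw' hs'
        obtain ⟨fuel, s', h⟩ := ih ts' s1 hw' hs'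
        exact ⟨fuel + 1, s', by rw [he, h]⟩
      cases his with
      | halt X =>
        refine bump ts s (fun _ => by simp [sexec]) ?_ hts
        have := hpos X
        simp [weight, pow_succ] at hw ⊢; omega
      | jump l X _ h1 =>
        refine bump ((X.drop l, ρ) :: ts) s (fun _ => by simp [sexec]) ?_ ?_
        · have := hpos X; have := hlt X l
          simp only [weight, List.map_cons, List.sum_cons, List.length_cons, pow_succ] at hw ⊢
          omega
        · intro t ht
          rcases List.mem_cons.1 ht with rfl | ht
          · exact h1
          · exact hts t ht
      | write X _ h1 =>
        refine bump (ts ++ [(X, ρ)]) _ (fun _ => by simp only [sexec]; rfl) ?_ ?_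
        · have := hpos X
          simp [weight, pow_succ] at hw ⊢; omega
        · simpa [or_imp, forall_and, h1] using hts
      | split p X _ hp h1 h2 =>
        refine bump (ts ++ [(X, Function.update ρ p (some true)),
          (X, Function.update ρ p (some false))]) s (fun _ => by simp [sexec, hp]) ?_ ?_
        · have := hpos X
          simp [weight, pow_succ] at hw ⊢; omega
        · simpa [or_imp, forall_and, h1, h2] using hts
      | posReply p X _ hp h1 h2 =>
        obtain ⟨v, hv⟩ := Option.ne_none_iff_exists'.1 hp
        refine bump (ts ++ [(if v then X else X.drop 1, ρ)]) s
          (fun _ => by simp [sexec, hv]) ?_ ?_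
        · have := hpos X; have := hlt X 1
          cases v <;>
          simp only [weight, List.map_cons, List.sum_cons, List.length_cons, pow_succ,
            List.map_append, List.sum_append, List.map_nil, List.sum_nil, if_true,
            Bool.false_eq_true, if_false] at hw ⊢ <;> omega
        · cases v <;> simp only [List.mem_append, List.mem_singleton] <;> rintro t (ht | rfl)
          exacts [hts t ht, h2, hts t ht, h1]
      | negReply p X _ hp h1 h2 =>
        obtain ⟨v, hv⟩ := Option.ne_none_iff_exists'.1 hp
        refine bump (ts ++ [(if v then X.drop 1 else X, ρ)]) s
          (fun _ => by simp [sexec, hv]) ?_ ?_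
        · have := hpos X; have := hlt X 1
          cases v <;>
          simp only [weight, List.map_cons, List.sum_cons, List.length_cons, pow_succ,
            List.map_append, List.sum_append, List.map_nil, List.sum_nil, if_true,
            Bool.false_eq_true, if_false] at hw ⊢ <;> omega
        · cases v <;> simp only [List.mem_append, List.mem_singleton] <;> rintro t (ht | rfl)
          exacts [hts t ht, h1, hts t ht, h2]
      | negGet j X _ h1 h2 =>
        refine bump (ts ++ [(if s (.inp j) then X.drop 1 else X, ρ)]) s
          (fun _ => by simp [sexec, BInstr.effect, BInstr.rpl]) ?_ ?_
        · have := hpos X; have := hlt X 1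
          cases s (.inp j) <;>
          simp only [weight, List.map_cons, List.sum_cons, List.length_cons, pow_succ,
            List.map_append, List.sum_append, List.map_nil, List.sum_nil, if_true,
            Bool.false_eq_true, if_false] at hw ⊢ <;> omega
        · cases s (.inp j) <;> simp only [List.mem_append, List.mem_singleton] <;>
            rintro t (ht | rfl)
          exacts [hts t ht, h1, hts t ht, h2]

/-! ### 3SATC is in PLSIS -/

/-- Tests the literals in turn; continues behind the code if one of them is true
and terminates otherwise. -/
def litCode : List (ℕ × Bool) → List PInstr
  | [] => [.halt]
  | (v, c) :: L => (if c then .pos (.reply v) else .neg (.reply v)) ::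
      .jump ((litCode L).length + 1) :: litCode L

/-- Tests the disjunction `L` provided that the input register `i` contains `true`. -/
def clauseCode (i : ℕ) (L : List (ℕ × Bool)) : List PInstr :=
  .neg (.get (.inp i)) :: .jump ((litCode L).length + 1) :: litCode L

/-- Code for the conjunction of guarded disjunctions over the variables `ps`. -/
def satCode (ps : List ℕ) (cs : List (ℕ × List (ℕ × Bool))) : List PInstr :=
  (ps.map fun p => .plain (.split p)) ++
    ((cs.flatMap fun c => clauseCode c.1 c.2) ++ [.plain (.set .out true), .halt])

theorem length_litCode (L : List (ℕ × Bool)) : (litCode L).length = 2 * L.length + 1 := by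
  induction L with
  | nil => simp [litCode]
  | cons l L ih => obtain ⟨v, c⟩ := l; simp [litCode, ih]; ring

theorem hits_litCode (x σ : ℕ → Bool) (L : List (ℕ × Bool)) (Y : List PInstr) :
    hits x σ (litCode L ++ Y) = (L.any (fun l => σ l.1 == l.2) && hits x σ Y) := by
  induction L with
  | nil => simp [litCode, hits]
  | cons l L ih =>
    obtain ⟨v, c⟩ := l
    cases c <;> cases hv : σ v <;> simp [litCode, hits, isSet, ans, hv, ih]

theorem hits_clauseCode (x σ : ℕ → Bool) (i : ℕ) (L : List (ℕ × Bool)) (Y : List PInstr) :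
    hits x σ (clauseCode i L ++ Y) =
      ((!x i || L.any (fun l => σ l.1 == l.2)) && hits x σ Y) := by
  cases hx : x i <;> simp [clauseCode, hits, isSet, ans, hx, hits_litCode]

theorem hits_satCode (x σ : ℕ → Bool) (ps : List ℕ) (cs : List (ℕ × List (ℕ × Bool))) :
    hits x σ (satCode ps cs) = true ↔
      ∀ c ∈ cs, x c.1 = true → ∃ l ∈ c.2, σ l.1 = l.2 := by
  have h1 : ∀ Y, hits x σ ((ps.map fun p => PInstr.plain (.split p)) ++ Y) = hits x σ Y := by
    intro Y
    induction ps with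
    | nil => rfl
    | cons p ps ih => simp [hits, isSet, ih]
  rw [satCode, h1]
  induction cs with
  | nil => simp [hits, isSet]
  | cons c cs ih =>
    rw [List.flatMap_cons, List.append_assoc, hits_clauseCode, Bool.and_eq_true,
      List.forall_mem_cons]
    refine (and_congr_right fun _ => ih).trans ?_
    cases x c.1 <;> simp

theorem safe_litCode {L : List (ℕ × Bool)} {ρ : PEnv} {Y : List PInstr}
    (hL : ∀ l ∈ L, ρ l.1 ≠ none) (hY : Safe Y ρ) : Safe (litCode L ++ Y) ρ := by
  induction L with
  | nil => exact Safe.halt _ _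
  | cons l L ih =>
    obtain ⟨v, c⟩ := l
    have h1 := ih fun l hl => hL l (List.mem_cons_of_mem _ hl)
    have hv := hL (v, c) List.mem_cons_self
    have h2 : Safe (.jump ((litCode L).length + 1) :: (litCode L ++ Y)) ρ :=
      Safe.jump _ _ _ (by simpa using hY)
    cases c
    · exact Safe.negReply v _ ρ hv h2 (by simpa using h1)
    · exact Safe.posReply v _ ρ hv h2 (by simpa using h1)

theorem safe_clauseCode {i : ℕ} {L : List (ℕ × Bool)} {ρ : PEnv} {Y : List PInstr}
    (hL : ∀ l ∈ L, ρ l.1 ≠ none) (hY : Safe Y ρ) : Safe (clauseCode i L ++ Y) ρ :=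
  Safe.negGet _ _ _ (Safe.jump _ _ _ (by simpa using hY)) (safe_litCode hL hY)

theorem safe_split {Y : List PInstr} (ps : List ℕ) : ∀ (ρ : PEnv), ps.Nodup →
    (∀ p ∈ ps, ρ p = none) →
    (∀ ρ', (∀ p, p ∈ ps ∨ ρ p ≠ none → ρ' p ≠ none) → Safe Y ρ') →
    Safe ((ps.map fun p => PInstr.plain (.split p)) ++ Y) ρ := by
  induction ps with
  | nil => intro ρ _ _ h; exact h ρ (by simp)
  | cons p ps ih =>
    intro ρ hnd hnone h
    have hn := List.nodup_cons.1 hnd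
    have main : ∀ v, Safe ((ps.map fun p => PInstr.plain (.split p)) ++ Y)
        (Function.update ρ p (some v)) := by
      intro v
      refine ih _ hn.2 (fun q hq => ?_) (fun ρ' hρ' => h ρ' fun q hq => hρ' q ?_)
      · have : q ≠ p := by rintro rfl; exact hn.1 hq
        simpa [Function.update_of_ne this] using hnone q (List.mem_cons_of_mem _ hq)
      · by_cases hqp : q = p
        · subst hqp; simp
        · simpa [Function.update_of_ne hqp, hqp] using hq
    exact Safe.split _ _ _ (hnone p List.mem_cons_self) (main true) (main false)

theorem safe_satCode {ps : List ℕ} {cs : List (ℕ × List (ℕ × Bool))} (hps : ps.Nodup)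
    (hcs : ∀ c ∈ cs, ∀ l ∈ c.2, l.1 ∈ ps) : Safe (satCode ps cs) fun _ => none := by
  refine safe_split ps _ hps (by simp) fun ρ hρ => ?_
  replace hcs : ∀ c ∈ cs, ∀ l ∈ c.2, ρ l.1 ≠ none :=
    fun c hc l hl => hρ _ (Or.inl (hcs c hc l hl))
  induction cs with
  | nil => exact Safe.write _ _ (Safe.halt _ _)
  | cons c cs ih =>
    rw [List.flatMap_cons, List.append_assoc]
    exact safe_clauseCode (hcs c List.mem_cons_self)
      (ih fun d hd => hcs d (List.mem_cons_of_mem _ hd))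

theorem allowed_satCode (ps : List ℕ) (cs : List (ℕ × List (ℕ × Bool))) :
    Allowed (satCode ps cs) := by
  have hl : ∀ L, ∀ u ∈ litCode L, InstrBasicOK SisBasic u := by
    intro L
    induction L with
    | nil => simp [litCode, InstrBasicOK]
    | cons l L ih =>
      obtain ⟨v, c⟩ := l
      cases c <;> simpa [litCode, InstrBasicOK, SisBasic] using ih
  intro u hu
  simp only [satCode, clauseCode, List.mem_append, List.mem_map, List.mem_flatMap,
    List.mem_cons, List.not_mem_nil, or_false] at hu
  rcases hu with ⟨p, _, rfl⟩ | ⟨c, _, rfl | rfl | h⟩ | rfl | rfl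
  · trivial
  · trivial
  · trivial
  · exact hl _ u h
  · trivial
  · trivial

theorem length_satCode_le {ps : List ℕ} {cs : List (ℕ × List (ℕ × Bool))}
    (hcs : ∀ c ∈ cs, c.2.length ≤ 3) :
    (satCode ps cs).length ≤ ps.length + 9 * cs.length + 2 := by
  have : (cs.flatMap fun c => clauseCode c.1 c.2).length ≤ 9 * cs.length := by
    induction cs with
    | nil => simp
    | cons c cs ih =>
      have h1 := ih fun d hd => hcs d (List.mem_cons_of_mem _ hd)
      have h2 := hcs c List.mem_cons_self
      have h3 : (clauseCode c.1 c.2).length = 2 * c.2.length + 3 := by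
        simp [clauseCode, length_litCode]
      simp only [List.flatMap_cons, List.length_append, List.length_cons, h3]
      omega
  simp only [satCode, List.length_append, List.length_map, List.length_cons, List.length_nil]
  omega

theorem ndisj_kOf_le (n : ℕ) : ndisj (kOf n) ≤ n :=
  Nat.findGreatest_spec (P := fun k => ndisj k ≤ n) (Nat.zero_le n) (by simp [ndisj])

theorem threeSATC_mem_PLSIS (A : AlphaFamily) : PLSIS (threeSATC A) := by
  refine ⟨10 * Polynomial.X + 3, fun n => ?_⟩
  have hm := ndisj_kOf_le n
  have hk : kOf n ≤ n := Nat.findGreatest_le n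
  set k := kOf n with hkdef
  let cs : List (ℕ × List (ℕ × Bool)) :=
    (List.range (ndisj k)).map fun i => (i, (A.α k (i+1)).toList)
  have hmem : ∀ c ∈ cs, ∃ i < ndisj k, c = (i, (A.α k (i+1)).toList) := by
    intro c hc
    obtain ⟨i, hi, rfl⟩ := List.mem_map.1 hc
    exact ⟨i, List.mem_range.1 hi, rfl⟩
  have hallow := allowed_satCode (List.range (k+1)) cs
  refine ⟨satCode (List.range (k+1)) cs, ⟨by simp [satCode], hallow⟩, fun b => ?_, ?_⟩
  · obtain ⟨fuel, s, h⟩ := sexec_terminates _ [(satCode (List.range (k+1)) cs, fun _ => none)]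
      (initState n b) le_rfl (by
        simp only [List.mem_singleton, forall_eq]
        refine safe_satCode List.nodup_range fun c hc l hl => ?_
        obtain ⟨i, hi, rfl⟩ := hmem c hc
        have := ((A.maps k (i+1) (by omega) (by omega)).2.2 l (Finset.mem_toList.1 hl)).2
        exact List.mem_range.2 (by omega))
    refine ⟨fuel, s, h, ?_⟩
    rw [Bool.eq_iff_iff, sexec_start hallow h]
    simp only [threeSATC, decide_eq_true_iff, hits_satCode, ← hkdef]
    refine exists_congr fun σ => ⟨fun H i hi hb => ?_, fun H c hc hx => ?_⟩
    · have := H (i.1, (A.α k (i+1)).toList) (List.mem_map.2 ⟨i.1, by simpa using hi, rfl⟩)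
        (by simpa [inputs, initState] using hb)
      simpa using this
    · obtain ⟨i, hi, rfl⟩ := hmem c hc
      have hin : i < n := by omega
      have := H ⟨i, hin⟩ (by simpa using hi) (by simpa [inputs, initState, hin] using hx)
      simpa using this
  · refine (length_satCode_le fun c hc => ?_).trans ?_
    · obtain ⟨i, hi, rfl⟩ := hmem c hc
      simpa using (A.maps k (i+1) (by omega) (by omega)).2.1
    · simp [cs]; omega

/-! ### Reducing families in PLSIS to 3SATC -/

/-- A clause together with an optional condition on an input register under
which it is imposed. -/
abbrev Rule := Option (ℕ × Bool) × Finset (ℕ × Bool)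

/-- The condition holds for the inputs `x`. -/
def guardHolds (x : ℕ → Bool) : Option (ℕ × Bool) → Bool
  | none => true
  | some (j, c) => x j == c

/-- The assignment `τ` satisfies all clauses of `R` imposed by the inputs `x`. -/
def Satisfies (x τ : ℕ → Bool) (R : List Rule) : Prop :=
  ∀ r ∈ R, guardHolds x r.1 = true → ∃ p ∈ r.2, τ p.1 = p.2

/-- Sets `out` to `true` if the condition holds. -/
def guardCode : Option (ℕ × Bool) → List PInstr
  | none => [.plain (.set .out true)]
  | some (j, true) => [.pos (.get (.inp j)), .plain (.set .out true)]
  | some (j, false) => [.neg (.get (.inp j)), .plain (.set .out true)]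

/-- Code computing the disjunction of the given conditions. -/
def orCode (gs : List (Option (ℕ × Bool))) : List PInstr := gs.flatMap guardCode ++ [.halt]

theorem exec_orCode (gs : List (Option (ℕ × Bool))) : ∀ s : RegState,
    ∃ s', exec (orCode gs) s = some s' ∧
      s' .out = (s .out || gs.any (guardHolds (inputs s))) := by
  induction gs with
  | nil => intro s; exact ⟨s, by simp [orCode, exec], by simp⟩
  | cons g gs ih =>
    intro s
    have hc : orCode (g :: gs) = guardCode g ++ orCode gs := by simp [orCode]
    have hset := ih (Function.update s .out true)
    rw [inputs_update_out] at hset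
    obtain ⟨s1, h1, h1'⟩ := hset
    obtain ⟨s2, h2, h2'⟩ := ih s
    rw [hc]
    match g with
    | none =>
      exact ⟨s1, by simpa [guardCode, exec, BInstr.isSplitReply, BInstr.effect] using h1,
        by simp [h1', guardHolds]⟩
    | some (j, c) =>
      cases hj : s (.inp j) <;> cases c
      · exact ⟨s1, by simpa [guardCode, exec, BInstr.isSplitReply, BInstr.effect,
          BInstr.rpl, hj] using h1, by simp [h1', guardHolds, inputs, hj]⟩
      · exact ⟨s2, by simpa [guardCode, exec, BInstr.isSplitReply, BInstr.effect,
          BInstr.rpl, hj] using h2, by simp [h2', guardHolds, inputs, hj]⟩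
      · exact ⟨s2, by simpa [guardCode, exec, BInstr.isSplitReply, BInstr.effect,
          BInstr.rpl, hj] using h2, by simp [h2', guardHolds, inputs, hj]⟩
      · exact ⟨s1, by simpa [guardCode, exec, BInstr.isSplitReply, BInstr.effect,
          BInstr.rpl, hj] using h1, by simp [h1', guardHolds, inputs, hj]⟩

theorem isbr_orCode (gs : List (Option (ℕ × Bool))) : ISbr (orCode gs) := by
  refine ⟨by simp [orCode], fun u hu => ?_⟩
  simp only [orCode, List.mem_append, List.mem_flatMap, List.mem_singleton] at hu
  rcases hu with ⟨g, _, hg⟩ | rfl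
  · match g, hg with
    | none, hg => simp only [guardCode, List.mem_singleton] at hg; subst hg; trivial
    | some (j, true), hg =>
      simp only [guardCode, List.mem_cons, List.not_mem_nil, or_false] at hg
      rcases hg with rfl | rfl <;> trivial
    | some (j, false), hg =>
      simp only [guardCode, List.mem_cons, List.not_mem_nil, or_false] at hg
      rcases hg with rfl | rfl <;> trivial
  · trivial

theorem length_orCode_le (gs : List (Option (ℕ × Bool))) :
    (orCode gs).length ≤ 2 * gs.length + 1 := by
  induction gs with
  | nil => simp [orCode]
  | cons g gs ih =>
    have hg : (guardCode g).length ≤ 2 := by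
      match g with
      | none => simp [guardCode]
      | some (j, true) => simp [guardCode]
      | some (j, false) => simp [guardCode]
    simp only [orCode, List.flatMap_cons, List.length_append, List.length_cons,
      List.length_nil] at ih ⊢
    omega

theorem ndisj_strictMono : StrictMono ndisj := by
  refine strictMono_nat_of_lt_succ fun k => ?_
  have h2 := Nat.choose_le_choose 2 (show 2 * k ≤ 2 * (k+1) by omega)
  have h3 := Nat.choose_le_choose 3 (show 2 * k ≤ 2 * (k+1) by omega)
  simp only [ndisj, Nat.choose_one_right]
  omega

theorem kOf_ndisj (k : ℕ) : kOf (ndisj k) = k := by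
  refine le_antisymm (ndisj_strictMono.le_iff_le.1 (ndisj_kOf_le _)) ?_
  exact Nat.le_findGreatest (P := fun j => ndisj j ≤ ndisj k) (ndisj_strictMono.le_apply) le_rfl

theorem ndisj_le (k : ℕ) : ndisj k ≤ 2 * k + (2 * k) ^ 2 + (2 * k) ^ 3 := by
  have h : ∀ j, Nat.choose (2 * k) j ≤ (2 * k) ^ j := Nat.choose_le_pow (2 * k)
  have h1 := h 1
  rw [pow_one] at h1
  have h2 := h 2
  have h3 := h 3
  simp only [ndisj]
  omega

/-- Satisfiability of the clauses imposed by the inputs reduces to 3SATC. -/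
theorem lengthRed_of_rules (A : AlphaFamily) {n : ℕ} {f : (Fin n → Bool) → Bool} {k : ℕ}
    {R : List Rule} (hR : ∀ r ∈ R, LitSetOK k r.2)
    (hf : ∀ b, f b = true ↔ ∃ τ, Satisfies (inputs (initState n b)) τ R) :
    LengthRed (2 * R.length + 1) f (threeSATC A (ndisj k)) := by
  let gs : Fin (ndisj k) → List (Option (ℕ × Bool)) := fun j =>
    (R.filter fun r => r.2 = A.α k (j.1+1)).map Prod.fst
  refine ⟨fun j b => (gs j).any (guardHolds (inputs (initState n b))), fun j => ?_, fun b => ?_⟩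
  · refine ⟨orCode (gs j), isbr_orCode _, fun b => ?_, (length_orCode_le _).trans ?_⟩
    · obtain ⟨s, hs, ho⟩ := exec_orCode (gs j) (initState n b)
      exact ⟨s, hs, by simp [ho, initState]⟩
    · have : (gs j).length ≤ R.length := by simpa [gs] using List.length_filter_le _ _
      omega
  · rw [Bool.eq_iff_iff, hf]
    simp only [threeSATC, decide_eq_true_iff, kOf_ndisj]
    refine exists_congr fun τ => ⟨fun H i _ hi => ?_, fun H r hr hg => ?_⟩
    · simp only [gs, List.any_eq_true, List.mem_map, List.mem_filter, decide_eq_true_iff] at hi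
      obtain ⟨g, ⟨r, ⟨hr, hα⟩, rfl⟩, hg⟩ := hi
      rw [← hα]
      exact H r hr hg
    · obtain ⟨i, hi1, hi2, hα⟩ := A.surj k r.2 (hR r hr)
      have hi' : i - 1 + 1 = i := by omega
      have := H ⟨i - 1, by omega⟩ (by simp only; omega) (by
        simp only [gs, List.any_eq_true, List.mem_map, List.mem_filter, decide_eq_true_iff]
        exact ⟨r.1, ⟨r, ⟨hr, by rw [hi', hα]⟩, rfl⟩, hg⟩)
      simpa only [hi', hα] using this

/-- Value at position `i` of the predicate "the run performs a write", obtained from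
its values `v` at later positions. -/
def next (N : ℕ) (x σ v : ℕ → Bool) (i : ℕ) : PInstr → Bool
  | .halt => false
  | .jump 0 => false
  | .jump (l+1) => v (min (i+1+l) N)
  | .plain a => isSet a || v (i+1)
  | .pos a => isSet a || if ans x σ a then v (i+1) else v (i+2)
  | .neg a => isSet a || if ans x σ a then v (i+2) else v (i+1)

/-- Instruction at position `i`, with termination behind the end. -/
def instrAt (X : List PInstr) (i : ℕ) : PInstr := X[i]?.getD .halt

theorem hits_drop (x σ : ℕ → Bool) (X : List PInstr) (i : ℕ) :
    hits x σ (X.drop i) =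
      next X.length x σ (fun j => hits x σ (X.drop j)) i (instrAt X i) := by
  by_cases hi : i < X.length
  · have hu : instrAt X i = X[i] := by simp [instrAt, hi]
    rw [List.drop_eq_getElem_cons hi, hu]
    cases X[i] with
    | plain a => simp [hits, next]
    | pos a => simp [hits, next]
    | neg a => simp [hits, next]
    | halt => simp [hits, next]
    | jump l =>
      cases l with
      | zero => simp [hits, next]
      | succ l =>
        simp only [hits, next, List.drop_drop]
        rcases le_total (i + 1 + l) X.length with h | h
        · rw [min_eq_left h]
        · rw [min_eq_right h, List.drop_eq_nil_of_le h, List.drop_length]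
  · have hu : instrAt X i = .halt := by simp [instrAt, not_lt.1 hi]
    rw [List.drop_eq_nil_of_le (not_lt.1 hi), hu]
    simp [hits, next]

/-- Clauses for a test at position `i` continuing at `t` or `f`; the variable `j+1`
stands for position `j` and the variable `z p` for the parameter `p`. -/
def branchRules (z : ℕ → ℕ) (i t f : ℕ) : BInstr → List Rule
  | .set _ _ => []
  | .get (.inp j) => [(some (j, true), {(i+1, false), (t+1, true)}),
      (some (j, false), {(i+1, false), (f+1, true)})]
  | .get _ => [(none, {(i+1, false), (f+1, true)})]
  | .split p => [(none, {(i+1, false), (z p, false), (t+1, true)}),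
      (none, {(i+1, false), (z p, true), (f+1, true)})]
  | .reply p => [(none, {(i+1, false), (z p, false), (t+1, true)}),
      (none, {(i+1, false), (z p, true), (f+1, true)})]

/-- Clauses for the instruction at position `i`. -/
def instrRules (N : ℕ) (z : ℕ → ℕ) (i : ℕ) : PInstr → List Rule
  | .halt => [(none, {(i+1, false)})]
  | .jump 0 => [(none, {(i+1, false)})]
  | .jump (l+1) => [(none, {(i+1, false), (min (i+1+l) N + 1, true)})]
  | .plain a => if isSet a then [] else [(none, {(i+1, false), (i+1+1, true)})]
  | .pos a => branchRules z i (i+1) (i+2) a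
  | .neg a => branchRules z i (i+2) (i+1) a

theorem satisfies_branchRules (x τ : ℕ → Bool) (z : ℕ → ℕ) (i t f : ℕ) (a : BInstr) :
    Satisfies x τ (branchRules z i t f a) ↔ (τ (i+1) = true →
      (isSet a || if ans x (fun p => τ (z p)) a then τ (t+1) else τ (f+1)) = true) := by
  match a with
  | .set _ _ => simp [branchRules, Satisfies, isSet]
  | .get (.inp j) =>
    cases hi : τ (i+1) <;> cases hj : x j <;>
      simp [branchRules, Satisfies, isSet, ans, guardHolds, or_and_right, exists_or,
        -Prod.exists, hi, hj]
  | .get (.aux j) =>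
    cases hi : τ (i+1) <;> simp [branchRules, Satisfies, isSet, ans, guardHolds, or_and_right, exists_or,
        -Prod.exists, hi]
  | .get .out =>
    cases hi : τ (i+1) <;> simp [branchRules, Satisfies, isSet, ans, guardHolds, or_and_right, exists_or,
        -Prod.exists, hi]
  | .split p =>
    cases hi : τ (i+1) <;> cases hz : τ (z p) <;>
      simp [branchRules, Satisfies, isSet, ans, guardHolds, or_and_right, exists_or,
        -Prod.exists, hi, hz]
  | .reply p =>
    cases hi : τ (i+1) <;> cases hz : τ (z p) <;>
      simp [branchRules, Satisfies, isSet, ans, guardHolds, or_and_right, exists_or,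
        -Prod.exists, hi, hz]

theorem satisfies_instrRules (N : ℕ) (x τ : ℕ → Bool) (z : ℕ → ℕ) (i : ℕ) (u : PInstr) :
    Satisfies x τ (instrRules N z i u) ↔ (τ (i+1) = true →
      next N x (fun p => τ (z p)) (fun j => τ (j+1)) i u = true) := by
  match u with
  | .halt => simp [instrRules, Satisfies, next, guardHolds]
  | .jump 0 => simp [instrRules, Satisfies, next, guardHolds]
  | .jump (l+1) =>
    cases hi : τ (i+1) <;> simp [instrRules, Satisfies, next, guardHolds, or_and_right, exists_or,
        -Prod.exists, hi]
  | .plain a =>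
    cases ha : isSet a <;> cases hi : τ (i+1) <;>
      simp [instrRules, Satisfies, next, guardHolds, or_and_right, exists_or,
        -Prod.exists, hi, ha]
  | .pos a => exact satisfies_branchRules x τ z i (i+1) (i+2) a
  | .neg a => exact satisfies_branchRules x τ z i (i+2) (i+1) a

/-- Parameter occurring in a basic instruction. -/
def basicParam : BInstr → Option ℕ
  | .split p => some p
  | .reply p => some p
  | _ => none

/-- Parameter occurring in a primitive instruction. -/
def instrParam : PInstr → Option ℕ
  | .plain a => basicParam a
  | .pos a => basicParam a
  | .neg a => basicParam a
  | _ => none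

theorem next_congr {N : ℕ} {x σ σ' v v' : ℕ → Bool} {i : ℕ} {u : PInstr}
    (hσ : ∀ p, instrParam u = some p → σ p = σ' p)
    (hv : ∀ j ≤ max N (i+2), v j = v' j) : next N x σ v i u = next N x σ' v' i u := by
  have h1 := hv (i+1) (by omega)
  have h2 := hv (i+2) (by omega)
  have hans : ∀ a, (∀ p, basicParam a = some p → σ p = σ' p) → ans x σ a = ans x σ' a := by
    intro a ha
    match a with
    | .set _ _ => rfl
    | .get (.inp j) => rfl
    | .get (.aux j) => rfl
    | .get .out => rfl
    | .split p => exact ha p rfl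
    | .reply p => exact ha p rfl
  match u, hσ with
  | .halt, _ => rfl
  | .jump 0, _ => rfl
  | .jump (l+1), _ => exact hv _ (by omega)
  | .plain a, _ => simp only [next, h1]
  | .pos a, hσ => simp only [next, h1, h2, hans a hσ]
  | .neg a, hσ => simp only [next, h1, h2, hans a hσ]

theorem next_mono {N : ℕ} {x σ v v' : ℕ → Bool} {i : ℕ} {u : PInstr} (hi : i < N)
    (hv : ∀ j, i < j → j ≤ N + 1 → v j = true → v' j = true)
    (h : next N x σ v i u = true) : next N x σ v' i u = true := by
  have h1 := hv (i+1) (by omega) (by omega)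
  have h2 := hv (i+2) (by omega) (by omega)
  match u, h with
  | .jump (l+1), h => exact hv _ (by omega) (by omega) h
  | .plain a, h =>
    simp only [next, Bool.or_eq_true] at h ⊢
    exact h.imp_right h1
  | .pos a, h =>
    revert h
    cases ha : isSet a <;> cases hb : ans x σ a <;> simp [next, ha, hb] <;> assumption
  | .neg a, h =>
    revert h
    cases ha : isSet a <;> cases hb : ans x σ a <;> simp [next, ha, hb] <;> assumption

/-- Variable standing for the parameter `p`. -/
def paramVar (X : List PInstr) (p : ℕ) : ℕ :=
  X.length + 3 + (X.filterMap instrParam).idxOf p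

/-- Clauses expressing that some parameter assignment makes `X` perform a write. -/
def rules (X : List PInstr) : List Rule :=
  (none, {(1, true)}) :: (List.range (X.length + 2)).flatMap fun i =>
    instrRules X.length (paramVar X) i (instrAt X i)

theorem satisfies_rules (x τ : ℕ → Bool) (X : List PInstr) :
    Satisfies x τ (rules X) ↔ τ 1 = true ∧ ∀ i < X.length + 2, τ (i+1) = true →
      next X.length x (fun p => τ (paramVar X p)) (fun j => τ (j+1)) i (instrAt X i) = true := by
  simp only [← satisfies_instrRules]
  simp only [Satisfies, rules, List.forall_mem_cons, List.mem_flatMap, List.mem_range]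
  refine and_congr (by simp [guardHolds]) ⟨fun H i hi r hr => H r ⟨i, hi, hr⟩, ?_⟩
  rintro H r ⟨i, hi, hr⟩
  exact H i hi r hr

theorem exists_satisfies_rules (x : ℕ → Bool) (X : List PInstr) :
    (∃ τ, Satisfies x τ (rules X)) ↔ ∃ σ, hits x σ X = true := by
  simp only [satisfies_rules]
  constructor
  · rintro ⟨τ, h0, H⟩
    refine ⟨fun p => τ (paramVar X p), ?_⟩
    have main : ∀ d i, X.length + 1 - i = d → i ≤ X.length + 1 → τ (i+1) = true →
        hits x (fun p => τ (paramVar X p)) (X.drop i) = true := by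
      intro d
      induction d using Nat.strong_induction_on with
      | _ d ih =>
        intro i hd hi hτ
        have hn := H i (by omega) hτ
        by_cases hiN : i < X.length
        · rw [hits_drop]
          exact next_mono hiN (fun j hj hj' hv => ih _ (by omega) j rfl hj' hv) hn
        · simp [instrAt, not_lt.1 hiN, next] at hn
    simpa using main _ 0 rfl (by omega) h0
  · rintro ⟨σ, hσ⟩
    let P := X.filterMap instrParam
    let τ : ℕ → Bool := fun v =>
      if v ≤ X.length + 2 then hits x σ (X.drop (v - 1)) else σ (P.getD (v - (X.length + 3)) 0)
    have hτ : ∀ j ≤ X.length + 1, τ (j+1) = hits x σ (X.drop j) := by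
      intro j hj
      simp only [τ, Nat.add_sub_cancel]
      rw [if_pos (by omega)]
    have hτp : ∀ p ∈ P, τ (paramVar X p) = σ p := by
      intro p hp
      have hlt : P.idxOf p < P.length := List.idxOf_lt_length_iff.2 hp
      have : paramVar X p - (X.length + 3) = P.idxOf p := by simp [paramVar, P]
      simp only [τ]
      rw [if_neg (by simp only [paramVar]; omega), this, List.getD_eq_getElem _ _ hlt,
        List.getElem_idxOf hlt]
    refine ⟨τ, by simpa using (hτ 0 (by omega)).trans hσ, fun i hi hv => ?_⟩
    by_cases hiN : i < X.length
    · rw [hτ i (by omega), hits_drop] at hv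
      rw [← hv]
      refine next_congr (fun p hp => hτp p ?_) (fun j hj => ?_)
      · refine List.mem_filterMap.2 ⟨X[i], List.getElem_mem hiN, ?_⟩
        simpa [instrAt, hiN] using hp
      · rw [hτ j (by omega)]
    · rw [hτ i (by omega), List.drop_eq_nil_of_le (not_lt.1 hiN)] at hv
      simp [hits] at hv

theorem length_rules_le (X : List PInstr) : (rules X).length ≤ 2 * X.length + 5 := by
  have hb : ∀ z i t f a, (branchRules z i t f a).length ≤ 2 := by
    intro z i t f a
    unfold branchRules
    split <;> simp
  have hi : ∀ N z i u, (instrRules N z i u).length ≤ 2 := by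
    intro N z i u
    unfold instrRules
    split <;> try first | exact hb _ _ _ _ _ | simp
    split_ifs <;> simp
  have hs : ∀ m, ((List.range m).flatMap fun i =>
      instrRules X.length (paramVar X) i (instrAt X i)).length ≤ 2 * m := by
    intro m
    induction m with
    | zero => simp
    | succ m ih =>
      have := hi X.length (paramVar X) m (instrAt X m)
      simp only [List.range_succ, List.flatMap_append, List.length_append, List.flatMap_cons,
        List.flatMap_nil, List.append_nil]
      omega
  have := hs (X.length + 2)
  simp only [rules, List.length_cons]
  omega

theorem litSetOK_one {k a : ℕ} {c : Bool} (ha : 1 ≤ a ∧ a ≤ k) : LitSetOK k {(a, c)} :=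
  ⟨by simp, by simp, by simpa using ha⟩

theorem litSetOK_two {k a a' : ℕ} {c c' : Bool} (ha : 1 ≤ a ∧ a ≤ k) (ha' : 1 ≤ a' ∧ a' ≤ k) :
    LitSetOK k {(a, c), (a', c')} :=
  ⟨by simp, Finset.card_le_two.trans (by norm_num), by simp [ha, ha']⟩

theorem litSetOK_three {k a a' a'' : ℕ} {c c' c'' : Bool} (ha : 1 ≤ a ∧ a ≤ k)
    (ha' : 1 ≤ a' ∧ a' ≤ k) (ha'' : 1 ≤ a'' ∧ a'' ≤ k) :
    LitSetOK k {(a, c), (a', c'), (a'', c'')} :=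
  ⟨by simp, Finset.card_le_three, by simp [ha, ha', ha'']⟩

theorem litSetOK_branchRules {k : ℕ} {z : ℕ → ℕ} {i t f : ℕ} (hz : ∀ p, 1 ≤ z p ∧ z p ≤ k)
    (hi : i + 1 ≤ k) (ht : t + 1 ≤ k) (hf : f + 1 ≤ k) (a : BInstr) :
    ∀ r ∈ branchRules z i t f a, LitSetOK k r.2 := by
  have h1 : 1 ≤ i + 1 ∧ i + 1 ≤ k := ⟨by omega, hi⟩
  have h2 : 1 ≤ t + 1 ∧ t + 1 ≤ k := ⟨by omega, ht⟩
  have h3 : 1 ≤ f + 1 ∧ f + 1 ≤ k := ⟨by omega, hf⟩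
  unfold branchRules
  split <;>
    simp only [List.not_mem_nil, List.mem_cons, or_false, forall_eq_or_imp, forall_eq,
      false_imp_iff, implies_true]
  · exact ⟨litSetOK_two h1 h2, litSetOK_two h1 h3⟩
  · exact litSetOK_two h1 h3
  · exact ⟨litSetOK_three h1 (hz _) h2, litSetOK_three h1 (hz _) h3⟩
  · exact ⟨litSetOK_three h1 (hz _) h2, litSetOK_three h1 (hz _) h3⟩

theorem litSetOK_rules {X : List PInstr} {k : ℕ} (hk : 2 * X.length + 4 ≤ k) :
    ∀ r ∈ rules X, LitSetOK k r.2 := by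
  have hz : ∀ p, 1 ≤ paramVar X p ∧ paramVar X p ≤ k := by
    intro p
    have h1 : (X.filterMap instrParam).idxOf p ≤ (X.filterMap instrParam).length :=
      List.idxOf_le_length
    have h2 : (X.filterMap instrParam).length ≤ X.length := List.length_filterMap_le _ _
    simp only [paramVar]
    omega
  intro r hr
  rcases List.mem_cons.1 hr with rfl | hr
  · exact litSetOK_one (by omega)
  obtain ⟨i, hi, hr⟩ := List.mem_flatMap.1 hr
  have hi := List.mem_range.1 hi
  generalize instrAt X i = u at hr
  match u, hr with
  | .halt, hr =>
    rw [List.mem_singleton.1 hr]; exact litSetOK_one (by omega)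
  | .jump 0, hr =>
    rw [List.mem_singleton.1 hr]; exact litSetOK_one (by omega)
  | .jump (l+1), hr =>
    rw [List.mem_singleton.1 hr]; exact litSetOK_two (by omega) (by omega)
  | .plain a, hr =>
    simp only [instrRules] at hr
    split_ifs at hr
    · simp at hr
    · rw [List.mem_singleton.1 hr]; exact litSetOK_two (by omega) (by omega)
  | .pos a, hr =>
    exact litSetOK_branchRules hz (by omega) (by omega) (by omega) a r hr
  | .neg a, hr =>
    exact litSetOK_branchRules hz (by omega) (by omega) (by omega) a r hr

theorem plRed_threeSATC (A : AlphaFamily) {G : (n : ℕ) → (Fin n → Bool) → Bool}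
    (hG : PLSIS G) : PLRed G (threeSATC A) := by
  obtain ⟨h, hh⟩ := hG
  let K : Polynomial ℕ := 2 * h + 4
  refine ⟨4 * h + 11 + (2 * K + (2 * K) ^ 2 + (2 * K) ^ 3), fun n => ?_⟩
  obtain ⟨X, hX, hc, hl⟩ := hh n
  have hlen := length_rules_le X
  have hm := ndisj_le (2 * h.eval n + 4)
  refine ⟨2 * (rules X).length + 1, ndisj (2 * h.eval n + 4), ?_, ?_,
    lengthRed_of_rules A (litSetOK_rules (by omega)) fun b => ?_⟩
  · simp only [Polynomial.eval_add, Polynomial.eval_mul, Polynomial.eval_ofNat]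
    omega
  · simp only [K, Polynomial.eval_add, Polynomial.eval_mul, Polynomial.eval_ofNat,
      Polynomial.eval_pow]
    omega
  · obtain ⟨fuel, s, hs, ho⟩ := hc b
    rw [exists_satisfies_rules, ← ho]
    exact sexec_start hX.2 hs

end Reg3SAT

/-- Theorem 10 of the paper: 3SATC is PLSIS-complete. -/
theorem statement12 (A : AlphaFamily) : PLSISComplete (threeSATC A) := by
  exact ⟨Reg3SAT.threeSATC_mem_PLSIS A, fun _ hG => Reg3SAT.plRed_threeSATC A hG⟩
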